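/- (Pointwise decay of $M_\phi(Ta)$ away from the supporting cube.) Fix an integer $N\ge 0$ and $0\le\alpha<n$, and let $K$ be a tempered distribution with $|\widehat{K}(\xi)|\le C|\xi|^{-\alpha}$ that agrees away from the origin with a $C^{N+1}$ function satisfying $|\partial^\beta K(x)|\le B_0|x|^{-(n-\alpha+|\beta|)}$ for all $|\beta|\le N+1$. Define $Tf=K*f$, let $\phi\in C_c^\infty$ with $\operatorname{supp}\phi\subset B(0,1)$ and $\int\phi\,dx=1$, and set $M_\phi g(x)=\sup_{t>0}|\phi_t*g(x)|$. Let $a$ be an $(N,\infty)$ atom with $\operatorname{supp}(a)\subset Q$. Then there is a constant $C'$, independent of $a$ and $Q$, such that for all $x\in(Q^*)^c$, $$M_\phi(Ta)(x)\le C'\,M_{\alpha_\tau}(\chi_Q)(x)^{\tau},$$ where $\tau=(n+N+1)/n$ and $\alpha_\tau=\alpha/\tau$. -/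

import Mathlib

open MeasureTheory ENNReal Filter Topology

noncomputable section

/-- Euclidean space `ℝⁿ`. -/
abbrev Rn (n : ℕ) := EuclideanSpace ℝ (Fin n)

variable {n : ℕ}

/-- The closed axis-parallel cube with center `c` and half side length `r`. -/
def stdCube (c : Rn n) (r : ℝ) : Set (Rn n) := {y | ∀ i, |y i - c i| ≤ r}

/-- A cube with sides parallel to the coordinate axes. -/
def IsCube (Q : Set (Rn n)) : Prop := ∃ (c : Rn n) (r : ℝ), 0 < r ∧ Q = stdCube c r

/-- The average `⨍_Q f` of `f` over `Q`. -/
def cubeAvg (Q : Set (Rn n)) (f : Rn n → ℝ) : ℝ := (volume Q).toReal⁻¹ * ∫ y in Q, f y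

/-- The average `⨍_Q f` of a nonnegative function over `Q`, computed in `ℝ≥0∞`. -/
def cubeAvgE (Q : Set (Rn n)) (f : Rn n → ℝ) : ℝ≥0∞ :=
  (∫⁻ y in Q, ENNReal.ofReal (f y)) / volume Q

/-- The `L^q` average `(⨍_Q f^q)^{1/q}` of a nonnegative function over `Q`, in `ℝ≥0∞`. -/
def cubeAvgEq (Q : Set (Rn n)) (f : Rn n → ℝ) (q : ℝ) : ℝ≥0∞ :=
  ((∫⁻ y in Q, ENNReal.ofReal (f y) ^ q) / volume Q) ^ (1/q)

/-- A weight: a nonnegative locally integrable function, positive a.e. -/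
def IsWeight (w : Rn n → ℝ) : Prop :=
  LocallyIntegrable w volume ∧ (∀ x, 0 ≤ w x) ∧ ∀ᵐ x ∂(volume : Measure (Rn n)), 0 < w x

/-- The Muckenhoupt `A_1` condition with constant `C`. -/
def MuckA1With (w : Rn n → ℝ) (C : ℝ) : Prop :=
  ∀ Q : Set (Rn n), IsCube Q → ∀ᵐ x ∂(volume : Measure (Rn n)), x ∈ Q → cubeAvg Q w ≤ C * w x

/-- The Muckenhoupt `A_r` condition (`1 < r`) with constant `C`. -/
def MuckArWith (w : Rn n → ℝ) (r C : ℝ) : Prop :=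
  ∀ Q : Set (Rn n), IsCube Q →
    cubeAvg Q w * (cubeAvg Q fun x => w x ^ (1 - r / (r - 1))) ^ (r - 1) ≤ C

/-- The Muckenhoupt `A_r` condition, `r ≥ 1`. -/
def MuckA (w : Rn n → ℝ) (r : ℝ) : Prop :=
  (r = 1 ∧ ∃ C : ℝ, 0 < C ∧ MuckA1With w C) ∨
  (1 < r ∧ ∃ C : ℝ, 0 < C ∧ MuckArWith w r C)

/-- The class `A_∞ = ⋃_{r ≥ 1} A_r`. -/
def AInfty (w : Rn n → ℝ) : Prop := ∃ r : ℝ, 1 ≤ r ∧ MuckA w r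

/-- `r_w = inf { r ≥ 1 : w ∈ A_r }`. -/
def rIdx (w : Rn n → ℝ) : ℝ := sInf {r : ℝ | 1 ≤ r ∧ MuckA w r}

/-- The reverse Hölder condition `RH_s` with constant `C`. -/
def RHWith (w : Rn n → ℝ) (s C : ℝ) : Prop :=
  ∀ Q : Set (Rn n), IsCube Q → (cubeAvg Q fun x => w x ^ s) ^ (1/s) ≤ C * cubeAvg Q w

/-- The reverse Hölder class `RH_s`, `1 < s < ∞`. -/
def RH (w : Rn n → ℝ) (s : ℝ) : Prop := ∃ C : ℝ, 0 < C ∧ RHWith w s C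

/-- The reverse Hölder class `RH_∞`. -/
def RHInfty (w : Rn n → ℝ) : Prop :=
  ∃ C : ℝ, 0 < C ∧ ∀ Q : Set (Rn n), IsCube Q →
    ∀ᵐ x ∂(volume : Measure (Rn n)), x ∈ Q → w x ≤ C * cubeAvg Q w

/-- The weighted Lebesgue quasi-norm `‖f‖_{L^p(w)}`. -/
def weightedLp (p : ℝ) (w : Rn n → ℝ) (f : Rn n → ℝ) : ℝ≥0∞ :=
  (∫⁻ x, ENNReal.ofReal |f x| ^ p * ENNReal.ofReal (w x)) ^ (1/p)

/-- The weighted Lebesgue quasi-norm, for `ℝ≥0∞`-valued functions. -/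
def weightedLpE (p : ℝ) (w : Rn n → ℝ) (F : Rn n → ℝ≥0∞) : ℝ≥0∞ :=
  (∫⁻ x, F x ^ p * ENNReal.ofReal (w x)) ^ (1/p)

/-- The variable Lebesgue quasi-norm `‖F‖_{L^{p(·)}}`, for `ℝ≥0∞`-valued functions. -/
def varLpE (p : Rn n → ℝ) (F : Rn n → ℝ≥0∞) : ℝ≥0∞ :=
  sInf {lam : ℝ≥0∞ | 0 < lam ∧ ∫⁻ x, (F x / lam) ^ (p x) ≤ 1}

/-- The variable Lebesgue quasi-norm `‖f‖_{L^{p(·)}}`. -/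
def varLp (p : Rn n → ℝ) (f : Rn n → ℝ) : ℝ≥0∞ :=
  varLpE p fun x => ENNReal.ofReal |f x|

/-- An exponent function in `𝒫₀`: measurable with values in `(0,∞)`. -/
def ExponentP0 (p : Rn n → ℝ) : Prop := Measurable p ∧ ∀ x, 0 < p x

/-- Log-Hölder continuity, locally and at infinity. -/
def LogHolder (p : Rn n → ℝ) : Prop :=
  (∃ C₀ : ℝ, 0 < C₀ ∧ ∀ x y : Rn n, 0 < ‖x - y‖ → ‖x - y‖ < 1/2 →
      |p x - p y| ≤ C₀ / (-Real.log ‖x - y‖)) ∧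
  (∃ pinf Cinf : ℝ, 0 < Cinf ∧ ∀ x : Rn n, |p x - pinf| ≤ Cinf / Real.log (Real.exp 1 + ‖x‖))

/-- The partial derivative `∂_i f`. -/
def pderiv (i : Fin n) (f : Rn n → ℝ) : Rn n → ℝ :=
  fun x => fderiv ℝ f x (EuclideanSpace.single i 1)

/-- The higher-order partial derivative `∂^β f` for a multi-index `β`. -/
def multiDeriv (β : Fin n → ℕ) (f : Rn n → ℝ) : Rn n → ℝ :=
  (List.finRange n).foldr (fun i g => (pderiv i)^[β i] g) f

/-- An `(N,∞)` atom supported in the cube `Q`. -/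
def IsNAtom (N : ℕ) (a : Rn n → ℝ) (Q : Set (Rn n)) : Prop :=
  Measurable a ∧ (∀ x, |a x| ≤ 1) ∧ IsCube Q ∧ Function.support a ⊆ Q ∧
    ∀ β : Fin n → ℕ, (∑ i, β i) ≤ N → ∫ x, (∏ i, x i ^ β i) * a x = 0

/-- Membership in `𝒪_N`: a smooth compactly supported function with vanishing moments
up to order `N`. -/
def InON (N : ℕ) (f : Rn n → ℝ) : Prop :=
  ContDiff ℝ (⊤ : ℕ∞) f ∧ HasCompactSupport f ∧
    ∀ β : Fin n → ℕ, (∑ i, β i) ≤ N → ∫ x, (∏ i, x i ^ β i) * f x = 0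

/-- Tempered distributions on `ℝⁿ`. -/
abbrev TemperedDist (n : ℕ) := SchwartzMap (Rn n) ℝ →L[ℝ] ℝ

/-- The tempered distribution `u` is represented by the function `f`. -/
def Represents (u : TemperedDist n) (f : Rn n → ℝ) : Prop :=
  ∀ ψ : SchwartzMap (Rn n) ℝ, u ψ = ∫ x, f x * ψ x

/-- Membership in the class `𝒮_{N₀}`:
`∫ (1+|x|)^{N₀} (∑_{|β| ≤ N₀} |∂^β φ(x)|²) dx ≤ 1`. -/
def inSN (N₀ : ℕ) (φ : SchwartzMap (Rn n) ℝ) : Prop :=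
  ∫ x : Rn n, (1 + ‖x‖) ^ N₀ *
      ∑ β : Fin n → Fin (N₀ + 1),
        (if (∑ i, (β i : ℕ)) ≤ N₀ then
          (multiDeriv (fun i => (β i : ℕ)) (fun y => φ y) x) ^ 2 else 0) ≤ 1

/-- The grand maximal function `𝓜_{N₀} u (x) = sup_{φ ∈ 𝒮_{N₀}} sup_{t>0} |φ_t * u (x)|`,
where `φ_t * u (x) = u (y ↦ t^{-n} φ((x-y)/t))`. -/
def grandMax (N₀ : ℕ) (u : TemperedDist n) (x : Rn n) : ℝ≥0∞ :=
  sSup {r : ℝ≥0∞ | ∃ (φ ψ : SchwartzMap (Rn n) ℝ) (t : ℝ), 0 < t ∧ inSN N₀ φ ∧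
      (∀ y, ψ y = ((t ^ n)⁻¹ : ℝ) * φ (t⁻¹ • (x - y))) ∧ r = ENNReal.ofReal |u ψ|}

/-- The weighted Hardy space quasi-norm `‖u‖_{H^p(w)} = ‖𝓜_{N₀} u‖_{L^p(w)}`. -/
def hardyNorm (N₀ : ℕ) (p : ℝ) (w : Rn n → ℝ) (u : TemperedDist n) : ℝ≥0∞ :=
  weightedLpE p w (grandMax N₀ u)

/-- The variable Hardy space quasi-norm `‖u‖_{H^{p(·)}} = ‖𝓜_{N₀} u‖_{L^{p(·)}}`. -/
def hardyNormVar (N₀ : ℕ) (p : Rn n → ℝ) (u : TemperedDist n) : ℝ≥0∞ :=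
  varLpE p (grandMax N₀ u)

/-- The fractional maximal operator `M_γ` (the Hardy–Littlewood maximal operator if
`γ = 0`). -/
def fracMax (γ : ℝ) (f : Rn n → ℝ) (x : Rn n) : ℝ≥0∞ :=
  ⨆ (Q : Set (Rn n)) (_ : IsCube Q ∧ x ∈ Q),
    volume Q ^ (γ / (n : ℝ)) * ((∫⁻ y in Q, ENNReal.ofReal |f y|) / volume Q)

/-- `T` is bounded on (unweighted) `L²`. -/
def L2Bounded (T : (Rn n → ℝ) → Rn n → ℝ) : Prop :=
  ∃ A : ℝ, 0 < A ∧ ∀ f : Rn n → ℝ, Measurable f →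
    weightedLp 2 (fun _ => 1) (T f) ≤ ENNReal.ofReal A * weightedLp 2 (fun _ => 1) f

/-- The standard kernel size estimate `|K(x,y)| ≤ C|x-y|^{-n}`. -/
def CZKernelSize (K : Rn n → Rn n → ℝ) (C : ℝ) : Prop :=
  ∀ x y : Rn n, x ≠ y → |K x y| ≤ C * ‖x - y‖ ^ (-(n : ℝ))

/-- The standard kernel smoothness (Hölder) estimate of order `δ`. -/
def CZKernelSmooth (K : Rn n → Rn n → ℝ) (δ C : ℝ) : Prop :=
  ∀ x y h : Rn n, x ≠ y → ‖h‖ ≤ ‖x - y‖ / 2 →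
    |K x (y + h) - K x y| + |K (x + h) y - K x y| ≤ C * ‖h‖ ^ δ * ‖x - y‖ ^ (-(n : ℝ) - δ)

/-- A (non-convolution type) Calderón–Zygmund operator: bounded on `L²`, represented off
the support by a kernel `K` satisfying the standard estimates with exponent `δ`. -/
def CZOp (T : (Rn n → ℝ) → Rn n → ℝ) (K : Rn n → Rn n → ℝ) (δ : ℝ) : Prop :=
  L2Bounded T ∧ 0 < δ ∧ δ ≤ 1 ∧
  (∃ C : ℝ, 0 < C ∧ CZKernelSize K C ∧ CZKernelSmooth K δ C) ∧
  ∀ f : Rn n → ℝ, Measurable f → (∃ M : ℝ, ∀ x, |f x| ≤ M) → HasCompactSupport f →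
    ∀ x ∉ tsupport f, T f x = ∫ y, K x y * f y

/-- The higher-order smoothness condition on the kernel:
`|∂_y^β K(x,y+h) - ∂_y^β K(x,y)| ≤ C |h|^δ |x-y|^{-(n+m+δ)}` for all `|β| = m`. -/
def KernelHigherSmooth (K : Rn n → Rn n → ℝ) (δ : ℝ) (m : ℕ) (C : ℝ) : Prop :=
  (∀ x : Rn n, ContDiffOn ℝ m (fun z => K x z) {x}ᶜ) ∧
  ∀ β : Fin n → ℕ, (∑ i, β i) = m →
    ∀ x y h : Rn n, x ≠ y → ‖h‖ ≤ ‖x - y‖ / 2 →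
      |multiDeriv β (fun z => K x z) (y + h) - multiDeriv β (fun z => K x z) y|
        ≤ C * ‖h‖ ^ δ * ‖x - y‖ ^ (-((n : ℝ) + m + δ))

/-- `T` has `L` vanishing moments: `∫ x^β T a(x) dx = 0` for all `(L+1,∞)` atoms `a` and
all multi-indices `|β| ≤ L`.  (Vacuous if `L = -1`.) -/
def VanishingMoments (T : (Rn n → ℝ) → Rn n → ℝ) (L : ℤ) : Prop :=
  ∀ (a : Rn n → ℝ) (Q : Set (Rn n)), IsNAtom (L + 1).toNat a Q →
    ∀ β : Fin n → ℕ, (∑ i, (β i : ℤ)) ≤ L → ∫ x, (∏ i, x i ^ β i) * T a x = 0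

/-- Regularity of order `N+1` for a convolution kernel:
`|∂^α K(x)| ≤ A |x|^{-n-|α|}` for all `|α| ≤ N+1`. -/
def ConvKernelReg (K : Rn n → ℝ) (N : ℕ) : Prop :=
  ContDiffOn ℝ (N + 1 : ℕ) K {0}ᶜ ∧
  ∃ A : ℝ, 0 < A ∧ ∀ β : Fin n → ℕ, (∑ i, β i) ≤ N + 1 →
    ∀ x : Rn n, x ≠ 0 → |multiDeriv β K x| ≤ A * ‖x‖ ^ (-(n : ℝ) - (∑ i, β i))

/-- A Calderón–Zygmund singular integral operator of convolution type with regularity of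
order `N+1`: `T` is bounded on `L²` (equivalently, the kernel has bounded Fourier
transform), and `T f(x) = p.v. ∫ K(x-y) f(y) dy` for `f ∈ C_c^∞`. -/
def ConvCZO (T : (Rn n → ℝ) → Rn n → ℝ) (K : Rn n → ℝ) (N : ℕ) : Prop :=
  L2Bounded T ∧ ConvKernelReg K N ∧
  ∀ f : Rn n → ℝ, ContDiff ℝ (⊤ : ℕ∞) f → HasCompactSupport f → ∀ x : Rn n,
    Tendsto (fun ε : ℝ => ∫ y in {y : Rn n | ε < ‖x - y‖}, K (x - y) * f y)
      (𝓝[>] 0) (𝓝 (T f x))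

/-- The fractional integral operator `I_α`. -/
def fracInt (α : ℝ) (f : Rn n → ℝ) (x : Rn n) : ℝ :=
  ∫ y, f y * ‖x - y‖ ^ (α - (n : ℝ))

/-- The radial maximal function `M_φ g(x) = sup_{t>0} |φ_t * g(x)|` of a function `g`. -/
def MphiSup (φ : Rn n → ℝ) (g : Rn n → ℝ) (x : Rn n) : ℝ≥0∞ :=
  ⨆ (t : ℝ) (_ : 0 < t), ENNReal.ofReal |∫ y, (t ^ n)⁻¹ * φ (t⁻¹ • (x - y)) * g y|

/-- The iterated partial derivative along a list of coordinate directions, the head being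
applied last. -/
def listDeriv (l : List (Fin n)) (f : Rn n → ℝ) : Rn n → ℝ :=
  l.foldr (fun i g => pderiv i g) f

lemma listDeriv_cons (i : Fin n) (l : List (Fin n)) (f : Rn n → ℝ) :
    listDeriv (i :: l) f = pderiv i (listDeriv l f) := rfl

lemma listDeriv_append (l l' : List (Fin n)) (f : Rn n → ℝ) :
    listDeriv (l ++ l') f = listDeriv l (listDeriv l' f) := by
  simp [listDeriv]

lemma listDeriv_replicate (k : ℕ) (i : Fin n) (f : Rn n → ℝ) :
    listDeriv (List.replicate k i) f = (pderiv i)^[k] f := by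
  induction k with
  | zero => rfl
  | succ k ih => rw [List.replicate_succ, listDeriv_cons, ih, Function.iterate_succ_apply']

lemma multiDeriv_eq_listDeriv (β : Fin n → ℕ) (f : Rn n → ℝ) :
    multiDeriv β f =
      listDeriv ((List.finRange n).flatMap fun i => List.replicate (β i) i) f := by
  unfold multiDeriv
  induction List.finRange n with
  | nil => rfl
  | cons i l ih =>
    rw [List.flatMap_cons, listDeriv_append, ← ih, listDeriv_replicate, List.foldr_cons]

lemma contDiffOn_pderiv {U : Set (Rn n)} (hU : IsOpen U) {f : Rn n → ℝ} {k : ℕ}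
    (hf : ContDiffOn ℝ (k + 1 : ℕ) f U) (i : Fin n) : ContDiffOn ℝ k (pderiv i f) U :=
  (hf.fderiv_of_isOpen hU (m := k) (by norm_cast)).clm_apply contDiffOn_const

lemma contDiffOn_listDeriv {U : Set (Rn n)} (hU : IsOpen U) {f : Rn n → ℝ} (l : List (Fin n)) :
    ∀ k : ℕ, ContDiffOn ℝ (l.length + k : ℕ) f U → ContDiffOn ℝ k (listDeriv l f) U := by
  induction l with
  | nil => intro k hf; simpa [listDeriv] using hf
  | cons i l ih =>
    intro k hf
    refine contDiffOn_pderiv hU (ih (k + 1) ?_) i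
    simpa [add_assoc, add_comm, add_left_comm] using hf

lemma pderiv_congr {U : Set (Rn n)} (hU : IsOpen U) {f g : Rn n → ℝ} (h : Set.EqOn f g U)
    (i : Fin n) : Set.EqOn (pderiv i f) (pderiv i g) U := by
  intro x hx
  have : f =ᶠ[𝓝 x] g := h.eventuallyEq_of_mem (hU.mem_nhds hx)
  simp only [pderiv, this.fderiv_eq]

lemma pderiv_comm {U : Set (Rn n)} (hU : IsOpen U) {f : Rn n → ℝ}
    (hf : ContDiffOn ℝ (2 : ℕ) f U) (i j : Fin n) :
    Set.EqOn (pderiv i (pderiv j f)) (pderiv j (pderiv i f)) U := by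
  intro x hx
  have hfx : ContDiffAt ℝ 2 f x := (hf.contDiffAt (hU.mem_nhds hx))
  have hsymm : IsSymmSndFDerivAt ℝ f x := hfx.isSymmSndFDerivAt (by simp)
  have hd : DifferentiableAt ℝ (fderiv ℝ f) x :=
    (hfx.fderiv_right (m := 1) (by norm_num)).differentiableAt (by norm_num)
  have key : ∀ u v : Rn n, fderiv ℝ (fun y => fderiv ℝ f y u) x v = fderiv ℝ (fderiv ℝ f) x v u := by
    intro u v
    rw [fderiv_clm_apply hd (differentiableAt_const u)]
    simp
  change fderiv ℝ (fun y => fderiv ℝ f y _) x _ = fderiv ℝ (fun y => fderiv ℝ f y _) x _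
  rw [key, key]
  exact hsymm.eq _ _

lemma listDeriv_perm {U : Set (Rn n)} (hU : IsOpen U) {f : Rn n → ℝ} {l l' : List (Fin n)}
    (h : l.Perm l') (hf : ContDiffOn ℝ l.length f U) :
    Set.EqOn (listDeriv l f) (listDeriv l' f) U := by
  induction h with
  | nil => exact Set.eqOn_refl _ _
  | cons i _ ih =>
    exact pderiv_congr hU (ih (hf.of_le (by simp))) i
  | swap i j l =>
    exact pderiv_comm hU (contDiffOn_listDeriv hU l 2 (by exact_mod_cast hf)) _ _
  | trans h₁ _ ih₁ ih₂ =>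
    exact (ih₁ hf).trans (ih₂ (by rwa [← h₁.length_eq]))

lemma List.perm_flatMap_replicate_count (l : List (Fin n)) :
    l.Perm ((List.finRange n).flatMap fun i => List.replicate (l.count i) i) := by
  rw [List.perm_iff_count]
  intro i
  rw [List.count_flatMap]
  simp only [Function.comp_def, List.count_replicate]
  rw [← List.sum_toFinset _ (List.nodup_finRange n)]
  simp

lemma listDeriv_eqOn_multiDeriv {U : Set (Rn n)} (hU : IsOpen U) {f : Rn n → ℝ}
    (l : List (Fin n)) (hf : ContDiffOn ℝ l.length f U) :
    Set.EqOn (listDeriv l f) (multiDeriv (fun i => l.count i) f) U := by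
  rw [multiDeriv_eq_listDeriv]
  exact listDeriv_perm hU l.perm_flatMap_replicate_count hf

lemma List.sum_count_fin (l : List (Fin n)) : ∑ i, l.count i = l.length := by
  simpa using Multiset.sum_count_eq_card (s := Finset.univ) (m := (l : Multiset (Fin n)))
    (fun _ _ => Finset.mem_univ _)

lemma hasDerivAt_comp_line {f : Rn n → ℝ} {p v : Rn n} {s : ℝ}
    (hf : DifferentiableAt ℝ f (p + s • v)) :
    HasDerivAt (fun s : ℝ => f (p + s • v)) (∑ i, v i * pderiv i f (p + s • v)) s := by
  have h1 : HasDerivAt (fun s : ℝ => p + s • v) v s := by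
    simpa using ((hasDerivAt_id s).smul_const v).const_add p
  have h2 := hf.hasFDerivAt.comp_hasDerivAt s h1
  convert! h2 using 1
  have hv : v = ∑ i, v i • EuclideanSpace.single i (1 : ℝ) := by
    ext j
    simp [Finset.sum_apply, Pi.single_apply]
  have h3 : fderiv ℝ f (p + s • v) v =
      fderiv ℝ f (p + s • v) (∑ i, v i • EuclideanSpace.single i (1 : ℝ)) := by rw [← hv]
  rw [h3]
  simp [pderiv, map_sum]

lemma iteratedDerivWithin_comp_line {U : Set (Rn n)} (hU : IsOpen U) {f : Rn n → ℝ} {p v : Rn n}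
    (hseg : ∀ s ∈ Set.Icc (0 : ℝ) 1, p + s • v ∈ U) (k : ℕ) (hf : ContDiffOn ℝ k f U) :
    ∀ s ∈ Set.Icc (0 : ℝ) 1,
      iteratedDerivWithin k (fun s : ℝ => f (p + s • v)) (Set.Icc 0 1) s =
        ∑ l : Fin k → Fin n, (∏ j, v (l j)) * listDeriv (List.ofFn l) f (p + s • v) := by
  induction k with
  | zero => intro s _; simp [listDeriv]
  | succ k ih =>
    intro s hs
    rw [iteratedDerivWithin_succ, derivWithin_congr (ih (hf.of_le (by norm_cast; simp)))
      (ih (hf.of_le (by norm_cast; simp)) s hs)]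
    have hder : ∀ l : Fin k → Fin n, HasDerivAt
        (fun s : ℝ => (∏ j, v (l j)) * listDeriv (List.ofFn l) f (p + s • v))
        ((∏ j, v (l j)) * ∑ i, v i * pderiv i (listDeriv (List.ofFn l) f) (p + s • v)) s := by
      intro l
      refine (hasDerivAt_comp_line ?_).const_mul _
      have := contDiffOn_listDeriv hU (f := f) (List.ofFn l) 1 (by simpa using hf)
      exact (this.contDiffAt (hU.mem_nhds (hseg s hs))).differentiableAt (by norm_num)
    rw [(HasDerivAt.fun_sum fun l _ => hder l).hasDerivWithinAt.derivWithin
      (uniqueDiffOn_Icc zero_lt_one s hs),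
      ← (Fin.consEquiv fun _ : Fin (k + 1) => Fin n).sum_comp, Fintype.sum_prod_type,
      Finset.sum_comm]
    refine Finset.sum_congr rfl fun l _ => ?_
    rw [Finset.mul_sum]
    refine Finset.sum_congr rfl fun i _ => ?_
    simp only [Fin.consEquiv, Equiv.coe_fn_mk, Fin.prod_univ_succ, Fin.cons_zero, Fin.cons_succ,
      List.ofFn_succ, listDeriv_cons]
    ring

lemma taylor_line_bound {U : Set (Rn n)} (hU : IsOpen U) {f : Rn n → ℝ} {p v : Rn n} {N : ℕ}
    (hseg : ∀ s ∈ Set.Icc (0 : ℝ) 1, p + s • v ∈ U) (hf : ContDiffOn ℝ (N + 1 : ℕ) f U)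
    {M ρ : ℝ} (hM0 : 0 ≤ M) (hρ : ‖v‖ ≤ ρ)
    (hM : ∀ l : List (Fin n), l.length = N + 1 → ∀ s ∈ Set.Icc (0 : ℝ) 1,
      |listDeriv l f (p + s • v)| ≤ M) :
    |f (p + v) - ∑ k ∈ Finset.range (N + 1), ∑ l : Fin k → Fin n,
      ((k.factorial : ℝ)⁻¹ * listDeriv (List.ofFn l) f p) * ∏ j, v (l j)|
        ≤ (n : ℝ) ^ (N + 1) * ρ ^ (N + 1) * M := by
  have hg : ContDiffOn ℝ (N + 1 : ℕ) (fun s : ℝ => f (p + s • v)) (Set.Icc 0 1) :=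
    hf.comp (by fun_prop) hseg
  have hb := taylor_mean_remainder_bound (f := fun s : ℝ => f (p + s • v)) (a := 0) (b := 1)
    (C := (n : ℝ) ^ (N + 1) * ρ ^ (N + 1) * M) (x := 1) (n := N) zero_le_one
    (by exact_mod_cast hg) (by simp) ?_
  · rw [taylor_within_apply] at hb
    have hfact : (1 : ℝ) ≤ N.factorial := by exact_mod_cast N.factorial_pos
    have hρ0 : 0 ≤ ρ := (norm_nonneg v).trans hρ
    refine le_trans (le_of_eq ?_) (hb.trans ((div_le_self (by positivity) hfact).trans (by simp)))
    rw [Real.norm_eq_abs]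
    congr 1
    simp only [one_smul, sub_zero, one_pow, mul_one, smul_eq_mul]
    congr 1
    refine Finset.sum_congr rfl fun k hk => ?_
    rw [iteratedDerivWithin_comp_line hU hseg k
      (hf.of_le (by norm_cast; exact (Finset.mem_range.1 hk).le)) 0 (by simp), Finset.mul_sum]
    refine Finset.sum_congr rfl fun l _ => ?_
    simp only [zero_smul, add_zero]
    ring
  · intro s hs
    rw [iteratedDerivWithin_comp_line hU hseg (N + 1) hf s hs]
    refine (norm_sum_le _ _).trans ?_
    have : ∀ l ∈ (Finset.univ : Finset (Fin (N + 1) → Fin n)),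
        ‖(∏ j, v (l j)) * listDeriv (List.ofFn l) f (p + s • v)‖ ≤ ρ ^ (N + 1) * M := by
      intro l _
      rw [norm_mul, norm_prod]
      refine mul_le_mul ?_ (hM _ (by simp) s hs) (norm_nonneg _)
        (pow_nonneg ((norm_nonneg v).trans hρ) _)
      calc ∏ j, ‖v (l j)‖ ≤ ∏ _j : Fin (N + 1), ρ :=
            Finset.prod_le_prod (fun _ _ => norm_nonneg _)
              fun j _ => (PiLp.norm_apply_le v (l j)).trans hρ
        _ = ρ ^ (N + 1) := by simp
    refine (Finset.sum_le_sum this).trans (le_of_eq ?_)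
    simp [mul_assoc]

lemma volume_stdCube (c : Rn n) {r : ℝ} (hr : 0 ≤ r) :
    volume (stdCube c r) = ENNReal.ofReal ((2 * r) ^ n) := by
  have h : stdCube c r = (WithLp.ofLp : Rn n → Fin n → ℝ) ⁻¹' Metric.closedBall (c : Fin n → ℝ) r := by
    ext y
    simp [stdCube, dist_pi_le_iff hr, Real.dist_eq]
  rw [h, (PiLp.volume_preserving_ofLp (Fin n)).measure_preimage
    Metric.isClosed_closedBall.measurableSet.nullMeasurableSet, Real.volume_pi_closedBall _ hr]
  simp

lemma isClosed_stdCube (c : Rn n) (r : ℝ) : IsClosed (stdCube c r) := by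
  simp only [stdCube, Set.ofPred_forall]
  exact isClosed_iInter fun i => isClosed_le (by fun_prop) continuous_const

lemma norm_sub_le_of_mem_stdCube {c z : Rn n} {r : ℝ} (hr : 0 ≤ r) (hz : z ∈ stdCube c r) :
    ‖z - c‖ ≤ √n * r := by
  rw [EuclideanSpace.norm_eq]
  refine Real.sqrt_le_iff.2 ⟨by positivity, ?_⟩
  rw [mul_pow, Real.sq_sqrt (by positivity)]
  calc ∑ i, ‖(z - c) i‖ ^ 2 ≤ ∑ _i : Fin n, r ^ 2 :=
        Finset.sum_le_sum fun i _ => pow_le_pow_left₀ (norm_nonneg _) (hz i) 2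
    _ = n * r ^ 2 := by simp

lemma isCompact_stdCube (c : Rn n) {r : ℝ} (hr : 0 ≤ r) : IsCompact (stdCube c r) :=
  (isCompact_closedBall c (√n * r)).of_isClosed_subset (isClosed_stdCube c r) fun z hz => by
    rw [mem_closedBall_iff_norm]
    exact norm_sub_le_of_mem_stdCube hr hz

lemma mul_lt_norm_sub_of_notMem_stdCube {c x : Rn n} {r : ℝ} (hx : x ∉ stdCube c r) :
    r < ‖x - c‖ := by
  simp only [stdCube, Set.mem_ofPred_eq, not_forall, not_le] at hx
  obtain ⟨i, hi⟩ := hx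
  exact hi.trans_le (PiLp.norm_apply_le (x - c) i)

lemma le_fracMax_indicator_rpow {γ p : ℝ} (hn : 0 < n) (hp : 0 ≤ p) {c x : Rn n} {r R : ℝ}
    (hr : 0 < r) (hrR : r ≤ R) (hx : x ∈ stdCube c R) :
    ENNReal.ofReal ((2 * R) ^ (γ * p) * (r / R) ^ (n * p)) ≤
      fracMax γ ((stdCube c r).indicator fun _ => (1 : ℝ)) x ^ p := by
  have hR : 0 < R := hr.trans_le hrR
  have hsub : stdCube c r ⊆ stdCube c R := fun z hz i => (hz i).trans hrR
  have hint : ∫⁻ y in stdCube c R,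
      ENNReal.ofReal |(stdCube c r).indicator (fun _ => (1 : ℝ)) y| = volume (stdCube c r) := by
    have : (fun y => ENNReal.ofReal |(stdCube c r).indicator (fun _ => (1 : ℝ)) y|) =
        (stdCube c r).indicator 1 := by
      ext y
      by_cases hy : y ∈ stdCube c r <;> simp [hy]
    rw [this, lintegral_indicator_one (isClosed_stdCube c r).measurableSet,
      Measure.restrict_apply (isClosed_stdCube c r).measurableSet,
      Set.inter_eq_self_of_subset_left hsub]
  have hle : ENNReal.ofReal (((2 * R) ^ n) ^ (γ / n) * ((2 * r) ^ n / (2 * R) ^ n)) ≤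
      fracMax γ ((stdCube c r).indicator fun _ => (1 : ℝ)) x := by
    refine le_trans (le_of_eq ?_)
      (le_iSup₂_of_le (stdCube c R) ⟨⟨c, R, hR, rfl⟩, hx⟩ le_rfl)
    rw [hint, volume_stdCube c hr.le, volume_stdCube c hR.le,
      ENNReal.ofReal_rpow_of_pos (by positivity), ENNReal.ofReal_mul (by positivity),
      ENNReal.ofReal_div_of_pos (by positivity)]
  refine le_trans (le_of_eq ?_) (ENNReal.rpow_le_rpow hle hp)
  rw [ENNReal.ofReal_rpow_of_nonneg (by positivity) hp]
  congr 1
  have hn' : (n : ℝ) ≠ 0 := by positivity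
  rw [← div_pow, mul_div_mul_left _ _ two_ne_zero,
    Real.mul_rpow (x := ((2 * R) ^ n) ^ (γ / n)) (by positivity) (by positivity),
    ← Real.rpow_natCast, ← Real.rpow_natCast, ← Real.rpow_mul (by positivity),
    ← Real.rpow_mul (by positivity), ← Real.rpow_mul (by positivity)]
  congr 2
  field_simp

section Atom

variable {N : ℕ} {a : Rn n → ℝ} {c : Rn n} {r : ℝ}

lemma IsNAtom.integrable_mul (ha : IsNAtom N a (stdCube c r)) (hr : 0 ≤ r) {g : Rn n → ℂ}
    (hg : Continuous g) : Integrable fun z => g z * (a z : ℂ) := by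
  obtain ⟨B, hB⟩ := (isCompact_stdCube c hr).exists_bound_of_continuousOn hg.continuousOn
  have hint : Integrable ((stdCube c r).indicator fun _ => B) :=
    (integrable_indicator_iff (isClosed_stdCube c r).measurableSet).2
      (integrableOn_const (isCompact_stdCube c hr).measure_lt_top.ne)
  refine hint.mono' ?_ (Eventually.of_forall fun z => ?_)
  · exact (hg.measurable.mul (Complex.measurable_ofReal.comp ha.1)).aestronglyMeasurable
  · by_cases hz : z ∈ stdCube c r
    · rw [Set.indicator_of_mem hz, norm_mul]
      refine (mul_le_of_le_one_right (norm_nonneg _) ?_).trans (hB z hz)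
      simpa using ha.2.1 z
    · have : a z = 0 := Function.notMem_support.1 fun h => hz (ha.2.2.2.1 h)
      simp [hz, this]

lemma IsNAtom.integrable_ofReal (ha : IsNAtom N a (stdCube c r)) (hr : 0 ≤ r) :
    Integrable fun z => (a z : ℂ) := by
  simpa using ha.integrable_mul hr (g := fun _ => 1) continuous_const

lemma IsNAtom.integral_eval_mul (ha : IsNAtom N a (stdCube c r)) (hr : 0 ≤ r)
    (P : MvPolynomial (Fin n) ℂ) (hP : P.totalDegree ≤ N) :
    ∫ z, MvPolynomial.eval (fun i => (z i : ℂ)) P * (a z : ℂ) = 0 := by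
  simp only [MvPolynomial.eval_eq', Finset.sum_mul]
  rw [integral_finsetSum]
  · refine Finset.sum_eq_zero fun d hd => ?_
    simp only [mul_assoc]
    rw [integral_const_mul]
    have hdeg : ∑ i, d i ≤ N := by
      refine le_trans ?_ ((MvPolynomial.le_totalDegree hd).trans hP)
      rw [Finsupp.sum_fintype _ _ fun _ => rfl]
    have h0 : ∫ z : Rn n, (∏ i, (z i : ℂ) ^ d i) * (a z : ℂ) = 0 := by
      have := ha.2.2.2.2 d hdeg
      rw [← Complex.ofReal_zero, ← this, ← integral_complex_ofReal]
      simp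
    rw [h0, mul_zero]
  · intro d _
    exact ha.integrable_mul hr (by fun_prop)

lemma IsNAtom.norm_integral_mul_le (ha : IsNAtom N a (stdCube c r)) (hr : 0 ≤ r)
    {g : Rn n → ℂ} (P : MvPolynomial (Fin n) ℂ) (hP : P.totalDegree ≤ N) {E : ℝ} (hE0 : 0 ≤ E)
    (hE : ∀ z ∈ stdCube c r, ‖g z - MvPolynomial.eval (fun i => (z i : ℂ)) P‖ ≤ E) :
    ‖∫ z, g z * (a z : ℂ)‖ ≤ E * (2 * r) ^ n := by
  by_cases hg : Integrable fun z => g z * (a z : ℂ)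
  · have hPc : Continuous fun z : Rn n => MvPolynomial.eval (fun i => (z i : ℂ)) P :=
      (MvPolynomial.continuous_eval P).comp (by fun_prop)
    have heq : ∫ z, g z * (a z : ℂ) =
        ∫ z, (g z - MvPolynomial.eval (fun i => (z i : ℂ)) P) * (a z : ℂ) := by
      simp only [sub_mul]
      rw [integral_sub hg (ha.integrable_mul hr hPc), ha.integral_eval_mul hr P hP, sub_zero]
    have hint : Integrable ((stdCube c r).indicator fun _ => E) :=
      (integrable_indicator_iff (isClosed_stdCube c r).measurableSet).2
        (integrableOn_const (isCompact_stdCube c hr).measure_lt_top.ne)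
    rw [heq]
    refine (norm_integral_le_of_norm_le hint (Eventually.of_forall fun z => ?_)).trans
      (le_of_eq ?_)
    · by_cases hz : z ∈ stdCube c r
      · rw [Set.indicator_of_mem hz, norm_mul]
        refine (mul_le_of_le_one_right (norm_nonneg _) ?_).trans (hE z hz)
        simpa using ha.2.1 z
      · have : a z = 0 := Function.notMem_support.1 fun h => hz (ha.2.2.2.1 h)
        simp [hz, this]
    · rw [integral_indicator_const _ (isClosed_stdCube c r).measurableSet, measureReal_def,
        volume_stdCube c hr, ENNReal.toReal_ofReal (by positivity), smul_eq_mul, mul_comm]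
  · rw [integral_undef hg, norm_zero]
    positivity

end Atom

lemma integral_mul_integral_comp_sub {A Φ h : Rn n → ℂ} {H : ℝ} (x : Rn n) (hA : Integrable A)
    (hΦ : Integrable Φ) (hh : AEStronglyMeasurable h) (hH : ∀ y, ‖h y‖ ≤ H) :
    ∫ y, h y * ∫ z, A z * Φ (x - y - z) = ∫ w, Φ w * ∫ z, h (x - w - z) * A z := by
  have hinner : ∀ u : Rn n, ∫ z, A z * Φ (u - z) = ∫ w, Φ w * A (u - w) := by
    intro u
    rw [← integral_sub_left_eq_self _ volume u]
    simp [mul_comm]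
  have hh' : AEStronglyMeasurable fun u => h (x - u) :=
    hh.comp_measurePreserving (Measure.measurePreserving_sub_left volume x)
  have hconv : Integrable (fun p : Rn n × Rn n => Φ p.2 * A (p.1 - p.2)) (volume.prod volume) :=
    hΦ.convolution_integrand (ContinuousLinearMap.mul ℝ ℂ) hA
  have hint : Integrable (fun p : Rn n × Rn n => h (x - p.1) * (Φ p.2 * A (p.1 - p.2)))
      (volume.prod volume) :=
    hconv.bdd_mul hh'.comp_fst (Eventually.of_forall fun p => hH _)
  calc ∫ y, h y * ∫ z, A z * Φ (x - y - z)
      = ∫ u, h (x - u) * ∫ w, Φ w * A (u - w) := by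
        rw [← integral_sub_left_eq_self _ volume x]
        simp [hinner]
    _ = ∫ u, ∫ w, h (x - u) * (Φ w * A (u - w)) := by simp only [integral_const_mul]
    _ = ∫ w, ∫ u, h (x - u) * (Φ w * A (u - w)) := integral_integral_swap hint
    _ = ∫ w, Φ w * ∫ z, h (x - w - z) * A z := by
        refine integral_congr_ae (Eventually.of_forall fun w => ?_)
        simp only
        rw [← integral_const_mul, ← integral_add_right_eq_self _ w]
        refine integral_congr_ae (Eventually.of_forall fun z => ?_)
        simp only [add_sub_cancel_right]
        rw [show x - (z + w) = x - w - z by abel]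
        ring

lemma norm_exp_sub_sum_le (N : ℕ) (θ : ℝ) :
    ‖Complex.exp (θ * Complex.I) -
      ∑ k ∈ Finset.range (N + 1), (θ * Complex.I) ^ k / k.factorial‖ ≤ 4 * |θ| ^ (N + 1) := by
  have hexp1 : Real.exp 1 ≤ 3 := Real.exp_one_lt_d9.le.trans (by norm_num)
  have hnorm : ‖(θ : ℂ) * Complex.I‖ = |θ| := by simp
  rcases le_total |θ| 1 with h | h
  · refine (Complex.norm_exp_sub_sum_le_norm_mul_exp _ _).trans ?_
    rw [hnorm, mul_comm]
    gcongr
    exact (Real.exp_le_exp.2 h).trans (by linarith)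
  · have hpow : 1 ≤ |θ| ^ (N + 1) := one_le_pow₀ h
    have hsum : ‖∑ k ∈ Finset.range (N + 1), ((θ : ℂ) * Complex.I) ^ k / k.factorial‖ ≤
        Real.exp 1 * |θ| ^ (N + 1) := by
      refine (norm_sum_le _ _).trans ?_
      calc ∑ k ∈ Finset.range (N + 1), ‖((θ : ℂ) * Complex.I) ^ k / k.factorial‖
          ≤ ∑ k ∈ Finset.range (N + 1), (1 : ℝ) ^ k / k.factorial * |θ| ^ (N + 1) := by
            refine Finset.sum_le_sum fun k hk => ?_
            rw [norm_div, norm_pow, hnorm, one_pow, div_mul_eq_mul_div, one_mul]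
            simp only [Complex.norm_natCast]
            gcongr
            exact (Finset.mem_range.1 hk).le
        _ = (∑ k ∈ Finset.range (N + 1), (1 : ℝ) ^ k / k.factorial) * |θ| ^ (N + 1) := by
            rw [Finset.sum_mul]
        _ ≤ _ := by
            gcongr
            exact Real.sum_le_exp_of_nonneg zero_le_one _
    have h1 : ‖Complex.exp (θ * Complex.I)‖ = 1 := Complex.norm_exp_ofReal_mul_I θ
    refine (norm_sub_le _ _).trans ?_
    rw [h1]
    nlinarith

lemma integrable_norm_rpow_mul_norm_schwartz (hn : 0 < n) {s : ℝ} {m : ℕ} (hs : -(n : ℝ) < s)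
    (hsm : s ≤ m) (f : SchwartzMap (Rn n) ℂ) :
    Integrable fun ξ : Rn n => ‖ξ‖ ^ s * ‖f ξ‖ := by
  have hmeas : AEStronglyMeasurable fun ξ : Rn n => ‖ξ‖ ^ s :=
    (measurable_norm.pow_const s).aestronglyMeasurable
  have hloc : LocallyIntegrable fun ξ : Rn n => ‖ξ‖ ^ s := by
    refine locallyIntegrable_of_norm_le_rpow (C := 1) (α := -s) (by simpa using Nat.succ_le_of_lt hn)
      (by simpa using by linarith) (Eventually.of_forall fun ξ => ?_) hmeas
    rw [neg_neg, one_mul, Real.norm_of_nonneg (by positivity)]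
  obtain ⟨B, hB⟩ := (isCompact_closedBall (0 : Rn n) 1).exists_bound_of_continuousOn
    f.continuous.continuousOn
  have h1 : Integrable ((Metric.closedBall (0 : Rn n) 1).indicator fun ξ => ‖ξ‖ ^ s * B) :=
    (integrable_indicator_iff Metric.isClosed_closedBall.measurableSet).2
      ((hloc.integrableOn_isCompact (isCompact_closedBall _ _)).mul_const B)
  have h2 : Integrable fun ξ : Rn n => ‖ξ‖ ^ m * ‖f ξ‖ := f.integrable_pow_mul volume m
  refine (h1.add h2).mono' (hmeas.mul f.continuous.norm.aestronglyMeasurable)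
    (Eventually.of_forall fun ξ => ?_)
  rw [Real.norm_of_nonneg (by positivity), Pi.add_apply]
  by_cases hξ : ξ ∈ Metric.closedBall (0 : Rn n) 1
  · rw [Set.indicator_of_mem hξ]
    refine le_add_of_le_of_nonneg ?_ (by positivity)
    gcongr
    exact hB ξ hξ
  · rw [Set.indicator_of_notMem hξ, zero_add]
    rw [mem_closedBall_zero_iff, not_le] at hξ
    gcongr
    rw [← Real.rpow_natCast]
    exact Real.rpow_le_rpow_of_exponent_le hξ.le hsm

lemma MvPolynomial.totalDegree_taylor_le {σ : Type*} (N : ℕ) (b : ∀ k, (Fin k → σ) → ℂ)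
    (c : σ → ℂ) [Fintype σ] :
    (∑ k ∈ Finset.range (N + 1), ∑ l : Fin k → σ,
      MvPolynomial.C (b k l) * ∏ j, (MvPolynomial.C (c (l j)) - MvPolynomial.X (l j))).totalDegree
        ≤ N := by
  refine MvPolynomial.totalDegree_finsetSum_le fun k hk => ?_
  refine MvPolynomial.totalDegree_finsetSum_le fun l _ => ?_
  refine (MvPolynomial.totalDegree_mul _ _).trans ?_
  rw [MvPolynomial.totalDegree_C, zero_add]
  refine (MvPolynomial.totalDegree_finsetProd _ _).trans ?_
  refine (Finset.sum_le_card_nsmul _ _ 1 fun j _ =>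
    (MvPolynomial.totalDegree_sub _ _).trans (by simp)).trans ?_
  simpa using Nat.lt_succ_iff.1 (Finset.mem_range.1 hk)

/-- The complexified `L¹`-normalized dilation `φ_t`. -/
def dilate (φ : Rn n → ℝ) (t : ℝ) (w : Rn n) : ℂ := (((t ^ n)⁻¹ * φ (t⁻¹ • w) : ℝ) : ℂ)

section Dilate

variable {φ : Rn n → ℝ} {t : ℝ}

lemma integrable_dilate (hφ : Integrable φ) (ht : 0 < t) : Integrable (dilate φ t) :=
  ((hφ.comp_smul (inv_ne_zero ht.ne')).const_mul _).ofReal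

lemma integral_dilate_mul (ht : 0 < t) (g : Rn n → ℂ) :
    ∫ w, dilate φ t w * g w = ∫ u, (φ u : ℂ) * g (t • u) := by
  have h := Measure.integral_comp_inv_smul (volume : Measure (Rn n))
    (fun u => (φ u : ℂ) * g (t • u)) t
  simp only [smul_inv_smul₀ ht.ne', finrank_euclideanSpace, Fintype.card_fin,
    abs_of_pos (pow_pos ht n)] at h
  have h' : ∫ w, dilate φ t w * g w =
      (((t ^ n)⁻¹ : ℝ) : ℂ) * ∫ w, (φ (t⁻¹ • w) : ℂ) * g w := by
    rw [← integral_const_mul]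
    simp only [dilate, Complex.ofReal_mul, mul_assoc]
  rw [h', h, Complex.real_smul, ← mul_assoc, ← Complex.ofReal_mul,
    inv_mul_cancel₀ (pow_pos ht n).ne', Complex.ofReal_one, one_mul]

lemma integral_norm_dilate (ht : 0 < t) : ∫ w, ‖dilate φ t w‖ = ∫ u, |φ u| := by
  have h := Measure.integral_comp_inv_smul (volume : Measure (Rn n)) (fun u => |φ u|) t
  simp only [finrank_euclideanSpace, Fintype.card_fin, abs_of_pos (pow_pos ht n)] at h
  simp only [dilate, Complex.norm_real, Real.norm_eq_abs, abs_mul,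
    abs_of_pos (inv_pos.2 (pow_pos ht n))]
  rw [integral_const_mul, h, smul_eq_mul, ← mul_assoc, inv_mul_cancel₀ (pow_pos ht n).ne', one_mul]

lemma norm_lt_of_dilate_ne_zero (hφc : tsupport φ ⊆ Metric.ball 0 1) (ht : 0 < t) {w : Rn n}
    (hw : dilate φ t w ≠ 0) : ‖w‖ < t := by
  have h : φ (t⁻¹ • w) ≠ 0 := fun h => hw (by simp [dilate, h])
  have := mem_ball_zero_iff.1 (hφc (subset_tsupport φ h))
  rwa [norm_smul, norm_inv, Real.norm_of_nonneg ht.le, inv_mul_lt_iff₀ ht, mul_one] at this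

end Dilate

lemma abs_listDeriv_le {N : ℕ} {α B₀ : ℝ} {K₀ : Rn n → ℝ}
    (hsmooth : ContDiffOn ℝ (N + 1 : ℕ) K₀ {0}ᶜ)
    (hbound : ∀ β : Fin n → ℕ, (∑ i, β i) ≤ N + 1 → ∀ x : Rn n, x ≠ 0 →
        |multiDeriv β K₀ x| ≤ B₀ * ‖x‖ ^ (-((n : ℝ) - α + (∑ i, β i))))
    {l : List (Fin n)} (hl : l.length ≤ N + 1) {x : Rn n} (hx : x ≠ 0) :
    |listDeriv l K₀ x| ≤ B₀ * ‖x‖ ^ (-((n : ℝ) - α + l.length)) := by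
  rw [listDeriv_eqOn_multiDeriv isOpen_compl_singleton l
    (hsmooth.of_le (by exact_mod_cast hl)) hx]
  have := hbound (fun i => l.count i) (by rwa [List.sum_count_fin]) x hx
  rwa [List.sum_count_fin] at this

lemma norm_integral_kernel_mul_atom_le {N : ℕ} {α B₀ : ℝ} {K₀ : Rn n → ℝ}
    (hαn : α < n) (hB₀ : 0 < B₀) (hsmooth : ContDiffOn ℝ (N + 1 : ℕ) K₀ {0}ᶜ)
    (hbound : ∀ β : Fin n → ℕ, (∑ i, β i) ≤ N + 1 → ∀ x : Rn n, x ≠ 0 →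
        |multiDeriv β K₀ x| ≤ B₀ * ‖x‖ ^ (-((n : ℝ) - α + (∑ i, β i))))
    {a : Rn n → ℝ} {c : Rn n} {r d : ℝ} (hr : 0 < r) (hd : 0 < d)
    (ha : IsNAtom N a (stdCube c r)) {p : Rn n} (hp : √n * r + d ≤ ‖p - c‖) {b : Rn n → ℂ}
    (hb : ∀ y, d ≤ ‖y‖ → b y = K₀ y) :
    ‖∫ z, b (p - z) * (a z : ℂ)‖ ≤
      (n : ℝ) ^ (N + 1) * (√n * r) ^ (N + 1) * (B₀ * d ^ (-((n : ℝ) - α + (N + 1 : ℕ)))) *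
        (2 * r) ^ n := by
  refine ha.norm_integral_mul_le hr.le (g := fun z => b (p - z))
    (∑ k ∈ Finset.range (N + 1), ∑ l : Fin k → Fin n,
      MvPolynomial.C (((k.factorial : ℝ)⁻¹ * listDeriv (List.ofFn l) K₀ (p - c) : ℝ) : ℂ) *
        ∏ j, (MvPolynomial.C (c (l j) : ℂ) - MvPolynomial.X (l j)))
    (MvPolynomial.totalDegree_taylor_le N _ fun i => (c i : ℂ)) (by positivity) fun z hz => ?_
  have hzc : ‖c - z‖ ≤ √n * r := by
    rw [norm_sub_rev]; exact norm_sub_le_of_mem_stdCube hr.le hz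
  have hfar : ∀ s ∈ Set.Icc (0 : ℝ) 1, d ≤ ‖(p - c) + s • (c - z)‖ := by
    intro s hs
    have h1 : ‖s • (c - z)‖ ≤ √n * r := by
      rw [norm_smul, Real.norm_of_nonneg hs.1]
      exact (mul_le_of_le_one_left (norm_nonneg _) hs.2).trans hzc
    have h2 := norm_sub_le ((p - c) + s • (c - z)) (s • (c - z))
    rw [add_sub_cancel_right] at h2
    linarith
  have hne : ∀ s ∈ Set.Icc (0 : ℝ) 1, (p - c) + s • (c - z) ≠ 0 := fun s hs h => by
    have := hfar s hs
    rw [h, norm_zero] at this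
    linarith
  have key := taylor_line_bound (U := {0}ᶜ) isOpen_compl_singleton (p := p - c) (v := c - z)
    (M := B₀ * d ^ (-((n : ℝ) - α + (N + 1 : ℕ)))) hne hsmooth (by positivity) hzc ?_
  · have hpz : (p - c) + (c - z) = p - z := by abel
    have hdpz : d ≤ ‖p - z‖ := by simpa [hpz] using hfar 1 (by simp)
    rw [hpz] at key
    refine le_trans (le_of_eq ?_) key
    rw [hb _ hdpz, ← Real.norm_eq_abs, ← Complex.norm_real]
    congr 1
    simp
  · intro l hl s hs
    refine (abs_listDeriv_le hsmooth hbound hl.le (hne s hs)).trans ?_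
    rw [hl]
    gcongr B₀ * ?_
    refine Real.rpow_le_rpow_of_nonpos hd (hfar s hs) ?_
    push_cast
    linarith [Nat.cast_nonneg (α := ℝ) N]

lemma norm_pairing_le_of_small_scale {N : ℕ} {α B₀ : ℝ} {K₀ : Rn n → ℝ}
    (hαn : α < n) (hB₀ : 0 < B₀) (hsmooth : ContDiffOn ℝ (N + 1 : ℕ) K₀ {0}ᶜ)
    (hbound : ∀ β : Fin n → ℕ, (∑ i, β i) ≤ N + 1 → ∀ x : Rn n, x ≠ 0 →
        |multiDeriv β K₀ x| ≤ B₀ * ‖x‖ ^ (-((n : ℝ) - α + (∑ i, β i))))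
    {φ : Rn n → ℝ} (hφ : Integrable φ) (hφc : tsupport φ ⊆ Metric.ball 0 1)
    {a : Rn n → ℝ} {c x : Rn n} {r d t : ℝ} (hr : 0 < r) (hd : 0 < d) (ht : 0 < t)
    (ha : IsNAtom N a (stdCube c r)) (hx : √n * r + d + t ≤ ‖x - c‖) {θ : Rn n → ℂ}
    (hθ : ∀ y, θ y = ∫ z, (a z : ℂ) * dilate φ t (x - y - z)) :
    (∀ y, ‖y‖ < d → θ y = 0) ∧
    ‖∫ y, (K₀ y : ℂ) * θ y‖ ≤ (∫ u, |φ u|) *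
      ((n : ℝ) ^ (N + 1) * (√n * r) ^ (N + 1) * (B₀ * d ^ (-((n : ℝ) - α + (N + 1 : ℕ)))) *
        (2 * r) ^ n) := by
  have hzero : ∀ y, ‖y‖ < d → θ y = 0 := by
    intro y hy
    rw [hθ]
    refine integral_eq_zero_of_ae (Eventually.of_forall fun z => ?_)
    by_contra hne
    obtain ⟨haz, hΦ⟩ := mul_ne_zero_iff.1 hne
    have h1 := norm_lt_of_dilate_ne_zero hφc ht hΦ
    have h2 := norm_sub_le_of_mem_stdCube hr.le
      (ha.2.2.2.1 (Function.mem_support.2 (Complex.ofReal_ne_zero.1 haz)))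
    have h3 : ‖x - c‖ ≤ ‖x - y - z‖ + ‖y‖ + ‖z - c‖ := by
      rw [show x - c = (x - y - z) + y + (z - c) by abel]
      exact norm_add₃_le
    linarith
  refine ⟨hzero, ?_⟩
  set b : Rn n → ℂ := {y : Rn n | d ≤ ‖y‖}.indicator fun y => (K₀ y : ℂ) with hb
  have hclosed : IsClosed {y : Rn n | d ≤ ‖y‖} := isClosed_le continuous_const continuous_norm
  have hbeq : ∀ y, d ≤ ‖y‖ → b y = K₀ y := fun y hy =>
    Set.indicator_of_mem (show y ∈ {y | d ≤ ‖y‖} from hy) _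
  have hne : ∀ y : Rn n, d ≤ ‖y‖ → y ≠ 0 := fun y hy h => by
    rw [h, norm_zero] at hy
    linarith
  have hbmeas : AEStronglyMeasurable b := by
    refine (aestronglyMeasurable_indicator_iff hclosed.measurableSet).2
      (ContinuousOn.aestronglyMeasurable ?_ hclosed.measurableSet)
    exact Complex.continuous_ofReal.comp_continuousOn (hsmooth.continuousOn.mono hne)
  have hbb : ∀ y, ‖b y‖ ≤ B₀ * d ^ (-((n : ℝ) - α)) := by
    intro y
    by_cases hy : d ≤ ‖y‖
    · rw [hbeq y hy, Complex.norm_real, Real.norm_eq_abs]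
      have := abs_listDeriv_le hsmooth hbound (l := []) (by simp) (hne y hy)
      simp only [List.length_nil, Nat.cast_zero, add_zero] at this
      refine (show |K₀ y| ≤ _ from this).trans ?_
      gcongr B₀ * ?_
      exact Real.rpow_le_rpow_of_nonpos hd hy (by linarith)
    · rw [hb, Set.indicator_of_notMem (by exact hy), norm_zero]
      positivity
  have hstep : ∫ y, (K₀ y : ℂ) * θ y =
      ∫ w, dilate φ t w * ∫ z, b (x - w - z) * (a z : ℂ) := by
    rw [← integral_mul_integral_comp_sub x (ha.integrable_ofReal hr.le)
      (integrable_dilate hφ ht) hbmeas hbb]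
    refine integral_congr_ae (Eventually.of_forall fun y => ?_)
    simp only [← hθ]
    by_cases hy : d ≤ ‖y‖
    · rw [hbeq y hy]
    · rw [hzero y (not_le.1 hy), mul_zero, mul_zero]
  rw [hstep, ← integral_norm_dilate ht, ← integral_mul_const]
  refine norm_integral_le_of_norm_le ((integrable_dilate hφ ht).norm.mul_const _)
    (Eventually.of_forall fun w => ?_)
  rw [norm_mul]
  by_cases hw : dilate φ t w = 0
  · simp [hw]
  · gcongr
    refine norm_integral_kernel_mul_atom_le hαn hB₀ hsmooth hbound hr hd ha ?_ hbeq
    have h1 := norm_lt_of_dilate_ne_zero hφc ht hw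
    have h2 : ‖x - c‖ ≤ ‖x - w - c‖ + ‖w‖ := by
      rw [show x - c = (x - w - c) + w by abel]
      exact norm_add_le _ _
    linarith

section FourierSide

open FourierTransform RealInnerProductSpace

lemma IsNAtom.norm_integral_exp_mul_le {N : ℕ} {a : Rn n → ℝ} {c : Rn n} {r : ℝ}
    (ha : IsNAtom N a (stdCube c r)) (hr : 0 ≤ r) (ξ : Rn n) :
    ‖∫ z, Complex.exp ((2 * Real.pi * ⟪c - z, ξ⟫ : ℝ) * Complex.I) * (a z : ℂ)‖ ≤
      4 * (2 * Real.pi * (√n * r * ‖ξ‖)) ^ (N + 1) * (2 * r) ^ n := by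
  set L : MvPolynomial (Fin n) ℂ := ∑ i, MvPolynomial.C (2 * Real.pi * ξ i : ℂ) *
    (MvPolynomial.C (c i : ℂ) - MvPolynomial.X i) with hL
  have hLdeg : L.totalDegree ≤ 1 := by
    refine MvPolynomial.totalDegree_finsetSum_le fun i _ => ?_
    refine (MvPolynomial.totalDegree_mul _ _).trans ?_
    rw [MvPolynomial.totalDegree_C, zero_add]
    exact (MvPolynomial.totalDegree_sub _ _).trans (by simp)
  have hLeval : ∀ z : Rn n, MvPolynomial.eval (fun i => (z i : ℂ)) L =
      (2 * Real.pi * ⟪c - z, ξ⟫ : ℝ) := by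
    intro z
    simp only [hL, map_sum, map_mul, map_sub, MvPolynomial.eval_C, MvPolynomial.eval_X,
      PiLp.inner_apply, PiLp.sub_apply, Finset.mul_sum, Complex.ofReal_sum]
    refine Finset.sum_congr rfl fun i _ => ?_
    simp
    ring
  refine ha.norm_integral_mul_le hr
    (∑ k ∈ Finset.range (N + 1), MvPolynomial.C (Complex.I ^ k / k.factorial) * L ^ k)
    (MvPolynomial.totalDegree_finsetSum_le fun k hk => ?_) (by positivity) fun z hz => ?_
  · refine (MvPolynomial.totalDegree_mul _ _).trans ?_
    rw [MvPolynomial.totalDegree_C, zero_add]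
    refine (MvPolynomial.totalDegree_pow _ _).trans ((Nat.mul_le_mul_left k hLdeg).trans ?_)
    simpa using Nat.lt_succ_iff.1 (Finset.mem_range.1 hk)
  · have hb := norm_exp_sub_sum_le N (2 * Real.pi * ⟪c - z, ξ⟫)
    refine le_trans (le_of_eq ?_) (hb.trans ?_)
    · simp only [map_sum, map_mul, map_pow, MvPolynomial.eval_C, hLeval]
      congr 2
      refine Finset.sum_congr rfl fun k _ => ?_
      ring
    · have hzc : ‖c - z‖ ≤ √n * r := by
        rw [norm_sub_rev]; exact norm_sub_le_of_mem_stdCube hr hz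
      gcongr 4 * ?_ ^ (N + 1)
      rw [abs_mul, abs_of_pos (by positivity : 0 < 2 * Real.pi)]
      gcongr
      exact (abs_real_inner_le_norm _ _).trans (by gcongr)

lemma norm_fourierInv_conv_atom_le {N : ℕ} {a : Rn n → ℝ} {c x : Rn n} {r t : ℝ}
    (ha : IsNAtom N a (stdCube c r)) (hr : 0 ≤ r) (ht : 0 < t) {φ : Rn n → ℝ}
    (hφ : Integrable φ) {θ : Rn n → ℂ}
    (hθ : ∀ y, θ y = ∫ z, (a z : ℂ) * dilate φ t (x - y - z)) (ξ : Rn n) :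
    ‖𝓕⁻ θ ξ‖ ≤ ‖𝓕 (fun u => (φ u : ℂ)) (t • ξ)‖ *
      (4 * (2 * Real.pi * (√n * r * ‖ξ‖)) ^ (N + 1) * (2 * r) ^ n) := by
  set e : Rn n → ℂ := fun y => Complex.exp ((2 * Real.pi * ⟪y, ξ⟫ : ℝ) * Complex.I) with he
  have hadd : ∀ u v, e (u + v) = e u * e v := by
    intro u v
    simp only [he, inner_add_left, mul_add, Complex.ofReal_add, add_mul, Complex.exp_add]
  have hnorm : ∀ y, ‖e y‖ = 1 := fun y => Complex.norm_exp_ofReal_mul_I _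
  have hcont : Continuous e := by
    simp only [he]
    fun_prop
  have hsplit : ∀ w, dilate φ t w * ∫ z, e (x - w - z) * (a z : ℂ) =
      e (x - c) * (∫ z, e (c - z) * (a z : ℂ)) * (dilate φ t w * e (-w)) := by
    intro w
    have : ∀ z, e (x - w - z) * (a z : ℂ) = e (x - c) * e (-w) * (e (c - z) * (a z : ℂ)) := by
      intro z
      rw [show x - w - z = (x - c) + (-w) + (c - z) by abel, hadd, hadd]
      ring
    simp only [this]
    rw [integral_const_mul]
    ring
  have hF : 𝓕 (fun u => (φ u : ℂ)) (t • ξ) = ∫ w, dilate φ t w * e (-w) := by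
    rw [integral_dilate_mul ht, Real.fourier_eq']
    refine integral_congr_ae (Eventually.of_forall fun u => ?_)
    simp only [he, smul_eq_mul]
    rw [mul_comm]
    congr 3
    simp [inner_smul_left, inner_smul_right]
  have hmain : 𝓕⁻ θ ξ = e (x - c) * (∫ z, e (c - z) * (a z : ℂ)) *
      𝓕 (fun u => (φ u : ℂ)) (t • ξ) := by
    rw [Real.fourierInv_eq', hF, ← integral_const_mul]
    simp only [← hsplit]
    rw [← integral_mul_integral_comp_sub x (ha.integrable_ofReal hr)
      (integrable_dilate hφ ht) hcont.aestronglyMeasurable (fun y => (hnorm y).le)]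
    simp only [← hθ, he, smul_eq_mul]
  rw [hmain, norm_mul, norm_mul, hnorm, one_mul, mul_comm]
  gcongr
  exact ha.norm_integral_exp_mul_le hr ξ

lemma norm_pairing_le_of_fourier_bound {N : ℕ} {α C : ℝ} (hn : 0 < n) (hα0 : 0 ≤ α)
    (hαn : α < n) {K : SchwartzMap (Rn n) ℂ →L[ℂ] ℂ} {k : Rn n → ℂ} (hC : 0 < C)
    (hK : ∀ ψ : SchwartzMap (Rn n) ℂ,
      K (SchwartzMap.fourierTransformCLM ℂ ψ) = ∫ ξ, k ξ * ψ ξ)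
    (hk : ∀ ξ : Rn n, ξ ≠ 0 → ‖k ξ‖ ≤ C * ‖ξ‖ ^ (-α))
    {φ : Rn n → ℝ} (φS : SchwartzMap (Rn n) ℂ) (hφS : ∀ u, φS u = φ u) (hφ : Integrable φ)
    {a : Rn n → ℝ} {c x : Rn n} {r t : ℝ} (ha : IsNAtom N a (stdCube c r)) (hr : 0 < r)
    (ht : 0 < t) (θ : SchwartzMap (Rn n) ℂ)
    (hθ : ∀ y, θ y = ∫ z, (a z : ℂ) * dilate φ t (x - y - z)) :
    ‖K θ‖ ≤ C * (4 * (2 * Real.pi * (√n * r)) ^ (N + 1) * (2 * r) ^ n) *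
      (∫ u : Rn n, ‖u‖ ^ ((N : ℝ) + 1 - α) * ‖𝓕 φS u‖) * t ^ (-((n : ℝ) + N + 1 - α)) := by
  have : Nonempty (Fin n) := ⟨⟨0, hn⟩⟩
  have hinv : SchwartzMap.fourierTransformCLM ℂ (𝓕⁻ θ) = θ := by
    rw [SchwartzMap.fourierTransformCLM_apply, FourierTransform.fourier_fourierInv_eq]
  have hφeq : (φS : Rn n → ℂ) = fun u => (φ u : ℂ) := funext hφS
  set s : ℝ := (N : ℝ) + 1 - α with hs
  set D : ℝ := 4 * (2 * Real.pi * (√n * r)) ^ (N + 1) * (2 * r) ^ n with hD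
  set G : Rn n → ℝ := fun u => ‖u‖ ^ s * ‖𝓕 φS u‖ with hG
  have hGint : Integrable G :=
    integrable_norm_rpow_mul_norm_schwartz hn (m := N + 1)
      (by rw [hs]; linarith [Nat.cast_nonneg (α := ℝ) N]) (by push_cast; linarith) (𝓕 φS)
  have hbound : ∀ᵐ ξ : Rn n, ‖k ξ * 𝓕⁻ θ ξ‖ ≤ C * D * t ^ (-s) * G (t • ξ) := by
    have hne : ∀ᵐ ξ : Rn n, ξ ≠ 0 := Measure.ae_ne volume 0
    filter_upwards [hne] with ξ hξ
    have hξ0 : 0 < ‖ξ‖ := norm_pos_iff.2 hξ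
    have h1 : ‖𝓕⁻ θ ξ‖ ≤ ‖𝓕 φS (t • ξ)‖ * (D * ‖ξ‖ ^ (N + 1)) := by
      have := norm_fourierInv_conv_atom_le ha hr.le ht hφ hθ ξ
      rw [← SchwartzMap.fourierInv_coe, ← hφeq, ← SchwartzMap.fourier_coe] at this
      refine this.trans (le_of_eq ?_)
      rw [hD]
      ring
    have h2 : t ^ (-s) * ‖t • ξ‖ ^ s = ‖ξ‖ ^ (-α) * ‖ξ‖ ^ (N + 1) := by
      rw [norm_smul, Real.norm_of_nonneg ht.le, Real.mul_rpow ht.le hξ0.le, ← mul_assoc,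
        ← Real.rpow_add ht, neg_add_cancel, Real.rpow_zero, one_mul, ← Real.rpow_natCast,
        ← Real.rpow_add hξ0]
      congr 1
      push_cast
      ring
    calc ‖k ξ * 𝓕⁻ θ ξ‖ = ‖k ξ‖ * ‖𝓕⁻ θ ξ‖ := norm_mul _ _
      _ ≤ (C * ‖ξ‖ ^ (-α)) * (‖𝓕 φS (t • ξ)‖ * (D * ‖ξ‖ ^ (N + 1))) := by
          gcongr
          exact hk ξ hξ
      _ = C * D * (‖ξ‖ ^ (-α) * ‖ξ‖ ^ (N + 1)) * ‖𝓕 φS (t • ξ)‖ := by ring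
      _ = C * D * t ^ (-s) * G (t • ξ) := by rw [← h2, hG]; ring
  have hle := norm_integral_le_of_norm_le ((hGint.comp_smul ht.ne').const_mul _) hbound
  rw [← hK, hinv, integral_const_mul, Measure.integral_comp_smul] at hle
  refine hle.trans (le_of_eq ?_)
  have hexp : -((n : ℝ) + N + 1 - α) = -s + -(n : ℝ) := by rw [hs]; ring
  rw [finrank_euclideanSpace, Fintype.card_fin, abs_of_pos (by positivity), smul_eq_mul, hexp,
    Real.rpow_add ht, Real.rpow_neg ht.le (n : ℝ), Real.rpow_natCast]
  ring

end FourierSide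

/-- (Pointwise decay of `M_φ(Ta)` away from the supporting cube.)
Let `K` be a tempered distribution with `|K̂(ξ)| ≤ C|ξ|^{-α}` that agrees away from the
origin with a `C^{N+1}` function `K₀` satisfying
`|∂^β K₀(x)| ≤ B₀|x|^{-(n-α+|β|)}` for `|β| ≤ N+1`, and let `Tf = K * f`.  Then for every
`(N,∞)` atom `a` supported in a cube `Q` and every `x ∈ (Q^*)^c`,
`M_φ(Ta)(x) ≤ C' M_{α_τ}(χ_Q)(x)^τ`, where `τ = (n+N+1)/n`, `α_τ = α/τ`.  Here
`φ_t * (Ta)(x) = K(y ↦ (a * φ_t)(x - y))`, so the bound is stated uniformly over all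
`t > 0` for this pairing. -/
theorem stmt17_maximal_decay_convolution (n : ℕ) (N : ℕ) (α : ℝ)
    (hα0 : 0 ≤ α) (hαn : α < n)
    (K : SchwartzMap (Rn n) ℂ →L[ℂ] ℂ) (K₀ : Rn n → ℝ)
    (hKhat : ∃ (k : Rn n → ℂ) (C : ℝ), 0 < C ∧
      (∀ φ : SchwartzMap (Rn n) ℂ,
        K (SchwartzMap.fourierTransformCLM ℂ φ) = ∫ ξ, k ξ * φ ξ) ∧
      ∀ ξ : Rn n, ξ ≠ 0 → ‖k ξ‖ ≤ C * ‖ξ‖ ^ (-α))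
    (hagree : ∀ φ : SchwartzMap (Rn n) ℂ, (∃ ε : ℝ, 0 < ε ∧ ∀ y : Rn n, ‖y‖ < ε → φ y = 0) →
      K φ = ∫ y, (K₀ y : ℂ) * φ y)
    (hK₀smooth : ContDiffOn ℝ (N + 1 : ℕ) K₀ {0}ᶜ)
    (hK₀bound : ∃ B₀ : ℝ, 0 < B₀ ∧ ∀ β : Fin n → ℕ, (∑ i, β i) ≤ N + 1 →
      ∀ x : Rn n, x ≠ 0 →
        |multiDeriv β K₀ x| ≤ B₀ * ‖x‖ ^ (-((n : ℝ) - α + (∑ i, β i))))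
    (φ : Rn n → ℝ) (hφs : ContDiff ℝ (⊤ : ℕ∞) φ)
    (hφc : tsupport φ ⊆ Metric.ball 0 1) (hφi : ∫ x, φ x = 1) :
    ∃ C' : ℝ, 0 < C' ∧
      ∀ (a : Rn n → ℝ) (c : Rn n) (r : ℝ), 0 < r → IsNAtom N a (stdCube c r) →
        ∀ x : Rn n, x ∉ stdCube c (2 * Real.sqrt n * r) →
          ∀ t : ℝ, 0 < t → ∀ θ : SchwartzMap (Rn n) ℂ,
            (∀ y, θ y = ((∫ z, a z * ((t ^ n)⁻¹ * φ (t⁻¹ • (x - y - z))) : ℝ) : ℂ)) →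
            ENNReal.ofReal ‖K θ‖ ≤ ENNReal.ofReal C' *
              fracMax (α / (((n : ℝ) + N + 1) / n))
                  ((stdCube c r).indicator fun _ => (1 : ℝ)) x ^ (((n : ℝ) + N + 1) / n) := by
  obtain ⟨k, C, hC, hK, hk⟩ := hKhat
  obtain ⟨B₀, hB₀, hbound⟩ := hK₀bound
  have hn : 0 < n := by exact_mod_cast hα0.trans_lt hαn
  have hn' : (n : ℝ) ≠ 0 := by positivity
  have hcomp : HasCompactSupport φ :=
    (isCompact_closedBall (0 : Rn n) 1).of_isClosed_subset (isClosed_tsupport φ)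
      (hφc.trans Metric.ball_subset_closedBall)
  have hφ : Integrable φ := hφs.continuous.integrable_of_hasCompactSupport hcomp
  have hcompC : HasCompactSupport fun u => (φ u : ℂ) :=
    hcomp.comp_left (g := fun y : ℝ => (y : ℂ)) Complex.ofReal_zero
  obtain ⟨φS, hφS⟩ : ∃ φS : SchwartzMap (Rn n) ℂ, ∀ u, φS u = φ u :=
    ⟨hcompC.toSchwartzMap (Complex.ofRealCLM.contDiff.comp hφs), fun _ => rfl⟩
  obtain ⟨J, hJ⟩ : ∃ J : ℝ,
      ∫ u : Rn n, ‖u‖ ^ ((N : ℝ) + 1 - α) * ‖FourierTransform.fourier φS u‖ = J := ⟨_, rfl⟩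
  have hJ0 : 0 ≤ J := hJ ▸ integral_nonneg fun u => by positivity
  set q : ℝ := (n : ℝ) + N + 1 - α with hq
  have hq0 : 0 ≤ q := by rw [hq]; linarith [Nat.cast_nonneg (α := ℝ) N]
  set C₁ : ℝ := (∫ u, |φ u|) * (n ^ (N + 1) * √n ^ (N + 1) * (B₀ * (1 / 4) ^ (-q)) * 2 ^ n)
    with hC₁
  set C₂ : ℝ := C * (4 * (2 * Real.pi * √n) ^ (N + 1) * 2 ^ n) * J *
    (1 / 4) ^ (-q) with hC₂
  have hC₁0 : 0 ≤ C₁ := by positivity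
  have hC₂0 : 0 ≤ C₂ := by positivity
  refine ⟨C₁ + C₂ + 1, by positivity, fun a c r hr ha x hx t ht θ hθ => ?_⟩
  set R : ℝ := ‖x - c‖ with hR
  have hsqrt : 1 ≤ √(n : ℝ) := Real.one_le_sqrt.2 (by exact_mod_cast hn)
  have hxR : 2 * √n * r < R := mul_lt_norm_sub_of_notMem_stdCube hx
  have hrR : r ≤ R := by nlinarith
  have hR0 : 0 < R := hr.trans_le hrR
  have hxmem : x ∈ stdCube c R := fun i => by
    simpa using PiLp.norm_apply_le (x - c) i
  have hθ' : ∀ y, θ y = ∫ z, (a z : ℂ) * dilate φ t (x - y - z) := by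
    intro y
    rw [hθ, ← integral_complex_ofReal]
    simp only [dilate, Complex.ofReal_mul]
  have hR4 : (R / 4) ^ (-q) = (1 / 4) ^ (-q) * R ^ (-q) := by
    rw [← Real.mul_rpow (by norm_num) hR0.le]
    ring_nf
  have hKθ : ‖K θ‖ ≤ (C₁ + C₂ + 1) * (r ^ (N + 1) * r ^ n * R ^ (-q)) := by
    have hX : 0 ≤ r ^ (N + 1) * r ^ n * R ^ (-q) := by positivity
    rcases le_or_gt t (R / 4) with htR | htR
    · obtain ⟨hvan, hle⟩ := norm_pairing_le_of_small_scale (d := R / 4) hαn hB₀ hK₀smooth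
        hbound hφ hφc hr (by positivity) ht ha (by rw [← hR]; linarith) hθ'
      rw [← hagree θ ⟨R / 4, by positivity, hvan⟩] at hle
      have hexp : -((n : ℝ) - α + (N + 1 : ℕ)) = -q := by rw [hq]; push_cast; ring
      rw [hexp, hR4] at hle
      calc ‖K θ‖ ≤ C₁ * (r ^ (N + 1) * r ^ n * R ^ (-q)) := by
            refine hle.trans (le_of_eq ?_)
            rw [hC₁, mul_pow, mul_pow]
            ring
        _ ≤ _ := mul_le_mul_of_nonneg_right (by linarith) hX
    · have hle := norm_pairing_le_of_fourier_bound hn hα0 hαn hC hK hk φS hφS hφ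
        ha hr ht θ hθ'
      rw [hJ] at hle
      have htq : t ^ (-q) ≤ (1 / 4) ^ (-q) * R ^ (-q) := by
        rw [← hR4]
        exact Real.rpow_le_rpow_of_nonpos (by positivity) htR.le (by linarith)
      calc ‖K θ‖ ≤ C * (4 * (2 * Real.pi * (√n * r)) ^ (N + 1) * (2 * r) ^ n) * J *
            ((1 / 4) ^ (-q) * R ^ (-q)) := by
            exact hle.trans (mul_le_mul_of_nonneg_left htq (by positivity))
        _ = C₂ * (r ^ (N + 1) * r ^ n * R ^ (-q)) := by
            rw [hC₂, ← mul_assoc (2 * Real.pi), mul_pow (2 * Real.pi * √n), mul_pow 2 r]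
            ring
        _ ≤ _ := mul_le_mul_of_nonneg_right (by linarith) hX
  set p : ℝ := ((n : ℝ) + N + 1) / n with hp
  have hp0 : 0 < p := by positivity
  have hlow := le_fracMax_indicator_rpow (γ := α / p) hn hp0.le hr hrR hxmem
  rw [div_mul_cancel₀ _ hp0.ne'] at hlow
  have hnp : (n : ℝ) * p = (n : ℝ) + N + 1 := by rw [hp]; field_simp
  have hcmp : r ^ (N + 1) * r ^ n * R ^ (-q) ≤ (2 * R) ^ α * (r / R) ^ (n * p) := by
    have hrpow : r ^ (N + 1) * r ^ n = r ^ ((n : ℝ) + N + 1) := by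
      rw [← pow_add, ← Real.rpow_natCast]
      congr 1
      push_cast
      ring
    rw [hnp, Real.div_rpow hr.le hR0.le, hrpow, hq,
      show -((n : ℝ) + N + 1 - α) = α - ((n : ℝ) + N + 1) by ring, Real.rpow_sub hR0]
    calc r ^ ((n : ℝ) + N + 1) * (R ^ α / R ^ ((n : ℝ) + N + 1))
        = R ^ α * (r ^ ((n : ℝ) + N + 1) / R ^ ((n : ℝ) + N + 1)) := by ring
      _ ≤ _ := by
        gcongr
        linarith
  calc ENNReal.ofReal ‖K θ‖
      ≤ ENNReal.ofReal ((C₁ + C₂ + 1) * ((2 * R) ^ α * (r / R) ^ (n * p))) :=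
        ENNReal.ofReal_le_ofReal (hKθ.trans (by gcongr))
    _ = ENNReal.ofReal (C₁ + C₂ + 1) * ENNReal.ofReal ((2 * R) ^ α * (r / R) ^ (n * p)) :=
        ENNReal.ofReal_mul (by positivity)
    _ ≤ _ := by gcongr
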